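/- Haagerup's inequality: Let F_k be the free group on k generators and let n be a natural number. If f : F_k → ℂ is a function supported on the set of elements of reduced word length exactly n, then the operator norm of the left convolution operator λ(f) = Σ_g f(g) λ(g) acting on ℓ²(F_k) satisfies ‖λ(f)‖ ≤ (n+1) ‖f‖₂, where ‖f‖₂ = (Σ_g |f(g)|²)^{1/2}. -/

import Mathlib

open scoped ENNReal

noncomputable section

variable {α : Type*}

private theorem lpShift_mem (e : α ≃ α) (ξ : lp (fun _ : α => ℂ) 2) :
    Memℓp (fun x => ξ (e x)) (2 : ℝ≥0∞) := by
  have hp : 0 < (2 : ℝ≥0∞).toReal := by norm_num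
  refine (memℓp_gen_iff hp).2 ?_
  exact e.summable_iff.2 ((memℓp_gen_iff hp).1 (lp.memℓp ξ))

/-- Composition with an index equivalence, as a continuous linear map on `ℓ²`. -/
def lpShift (e : α ≃ α) :
    lp (fun _ : α => ℂ) 2 →L[ℂ] lp (fun _ : α => ℂ) 2 :=
  LinearMap.mkContinuous
    { toFun := fun ξ => (⟨fun x => ξ (e x), lpShift_mem e ξ⟩ : lp (fun _ : α => ℂ) 2)
      map_add' := fun ξ η => lp.ext <| funext fun x => by
        simp only [lp.coeFn_add, Pi.add_apply]
      map_smul' := fun c ξ => lp.ext <| funext fun x => by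
        simp only [lp.coeFn_smul, Pi.smul_apply, RingHom.id_apply] } 1 <| by
    intro ξ
    have hp : 0 < (2 : ℝ≥0∞).toReal := by norm_num
    have : ‖(⟨fun x => ξ (e x), lpShift_mem e ξ⟩ : lp (fun _ : α => ℂ) 2)‖ = ‖ξ‖ := by
      rw [lp.norm_eq_tsum_rpow hp, lp.norm_eq_tsum_rpow hp]
      congr 1
      exact e.tsum_eq fun x => ‖ξ x‖ ^ (2 : ℝ≥0∞).toReal
    simpa using this.le

/-- The left regular representation of a group `G` on `ℓ²(G)`:
`(lam g ξ) x = ξ (g⁻¹ * x)`. -/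
def lam {G : Type*} [Group G] (g : G) :
    lp (fun _ : G => ℂ) 2 →L[ℂ] lp (fun _ : G => ℂ) 2 :=
  lpShift (Equiv.mulLeft g⁻¹)

theorem word_split {β : Type*} [DecidableEq β] (L₂ : List (β × Bool)) (h2 : FreeGroup.IsReduced L₂) :
    ∀ L₁ : List (β × Bool), FreeGroup.IsReduced L₁ →
    ∃ A B C, L₁ = A ++ B ∧ L₂ = FreeGroup.invRev B ++ C ∧
      FreeGroup.reduce (L₁ ++ L₂) = A ++ C := by
  intro L₁
  induction L₁ with
  | nil =>
    intro _
    exact ⟨[], [], L₂, rfl, by simp, by simpa using h2.reduce_eq⟩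
  | cons x L ih =>
    intro h1
    have hL : FreeGroup.IsReduced L := by
      unfold FreeGroup.IsReduced at h1 ⊢
      exact h1.tail
    obtain ⟨A, B, C, e1, e2, e3⟩ := ih hL
    have key : FreeGroup.reduce (x :: L ++ L₂) = FreeGroup.reduce (x :: (A ++ C)) := by
      rw [← e3, FreeGroup.reduce_cons_reduce]; rfl
    have hAC : FreeGroup.IsReduced (A ++ C) := by
      rw [FreeGroup.isReduced_iff_reduce_eq, ← e3, FreeGroup.reduce.idem]
    by_cases hr : FreeGroup.IsReduced (x :: (A ++ C))
    · exact ⟨x :: A, B, C, by simp [e1], e2, by rw [key, hr.reduce_eq]; rfl⟩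
    · cases A with
      | cons a A =>
        exfalso; apply hr
        subst e1
        unfold FreeGroup.IsReduced at h1 hAC ⊢
        simp only [List.cons_append, List.isChain_cons_cons] at h1 hAC ⊢
        exact ⟨h1.1, hAC⟩
      | nil =>
        cases C with
        | nil => exact absurd (by simp [FreeGroup.IsReduced]) hr
        | cons c C =>
          have hc : x.1 = c.1 ∧ x.2 = !c.2 := by
            unfold FreeGroup.IsReduced at hr hAC
            simp only [List.nil_append, List.isChain_cons_cons] at hr hAC
            by_contra hh
            apply hr
            refine ⟨fun h => ?_, hAC⟩
            by_contra h'
            apply hh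
            refine ⟨h, ?_⟩
            revert h'
            cases x.2 <;> cases c.2 <;> simp
          refine ⟨[], x :: B, C, by simpa using e1, ?_, ?_⟩
          · rw [e2]
            obtain ⟨c1, c2⟩ := c
            simp [FreeGroup.invRev, hc.1, hc.2]
          · rw [key]
            have h5 : FreeGroup.reduce (c :: C) = c :: C := by
              simpa using hAC.reduce_eq
            rw [List.nil_append, FreeGroup.reduce.cons, h5]
            simp [hc]

theorem group_split {k : ℕ} (n : ℕ) (g x : FreeGroup (Fin k)) (hg : g.norm = n) :
    ∃ p ∈ Finset.range (n + 1), g.toWord.take (n - p) = x.toWord.take (n - p) ∧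
      g.toWord = g.toWord.take (n - p) ++ FreeGroup.invRev ((g⁻¹ * x).toWord.take p) := by
  obtain ⟨A, B, C, e1, e2, e3⟩ := word_split (g⁻¹ * x).toWord FreeGroup.isReduced_toWord g.toWord
    FreeGroup.isReduced_toWord
  rw [← FreeGroup.toWord_mul, mul_inv_cancel_left] at e3
  have hlen : A.length + B.length = n := by
    rw [← hg, FreeGroup.norm, e1, List.length_append]
  have h : n - B.length = A.length := by omega
  refine ⟨B.length, by simp; omega, ?_, ?_⟩
  · rw [h, e1, e3]; simp
  · rw [h, e2, e1]
    have : B.length = (FreeGroup.invRev B).length := by simp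
    rw [this, List.take_left]
    simp

theorem piece_bound {G W : Type*} [Group G] [DecidableEq G] [DecidableEq W]
    (S s : Finset G) (f ξ : G → ℂ)
    (a : G → W) (P : G → G → Prop) [∀ g x, Decidable (P g x)]
    (hP : ∀ g x, P g x → a g = a x)
    (hinj : ∀ g x g' x', P g x → P g' x' → a g = a g' → g⁻¹ * x = g'⁻¹ * x' → g = g')
    (M : ℝ) (hM : ∀ t : Finset G, ∑ y ∈ t, ‖ξ y‖ ^ 2 ≤ M) :
    ∑ x ∈ s, (∑ g ∈ S with P g x, ‖f g‖ * ‖ξ (g⁻¹ * x)‖) ^ 2 ≤ (∑ g ∈ S, ‖f g‖ ^ 2) * M := by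
  have h1 : ∀ x ∈ s, (∑ g ∈ S with P g x, ‖f g‖ * ‖ξ (g⁻¹ * x)‖) ^ 2 ≤
      ∑ g' ∈ S, ‖f g'‖ ^ 2 * (if a g' = a x then
        ∑ g ∈ S with P g x, ‖ξ (g⁻¹ * x)‖ ^ 2 else 0) := by
    intro x _
    refine (Finset.sum_mul_sq_le_sq_mul_sq _ _ _).trans ?_
    simp only [mul_ite, mul_zero]
    rw [← Finset.sum_filter, ← Finset.sum_mul]
    refine mul_le_mul_of_nonneg_right ?_ (Finset.sum_nonneg fun _ _ => sq_nonneg _)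
    refine Finset.sum_le_sum_of_subset_of_nonneg ?_ fun _ _ _ => sq_nonneg _
    intro g hg
    simp only [Finset.mem_filter] at hg ⊢
    exact ⟨hg.1, hP _ _ hg.2⟩
  refine (Finset.sum_le_sum h1).trans ?_
  rw [Finset.sum_comm, Finset.sum_mul]
  refine Finset.sum_le_sum fun g' _ => ?_
  rw [← Finset.mul_sum]
  refine mul_le_mul_of_nonneg_left ?_ (sq_nonneg _)
  have h2 : ∑ x ∈ s, (if a g' = a x then ∑ g ∈ S with P g x, ‖ξ (g⁻¹ * x)‖ ^ 2 else 0) =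
      ∑ q ∈ (s ×ˢ S).filter (fun q => a g' = a q.1 ∧ P q.2 q.1), ‖ξ (q.2⁻¹ * q.1)‖ ^ 2 := by
    rw [Finset.sum_filter, Finset.sum_product]
    refine Finset.sum_congr rfl fun x _ => ?_
    by_cases h : a g' = a x
    · simp [h, Finset.sum_filter]
    · simp [h]
  rw [h2]
  refine le_trans (le_of_eq ?_)
    (hM (((s ×ˢ S).filter (fun q => a g' = a q.1 ∧ P q.2 q.1)).image (fun q => q.2⁻¹ * q.1)))
  rw [Finset.sum_image]
  rintro ⟨x, g⟩ h ⟨x', g''⟩ h' e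
  simp only [Finset.coe_filter, Set.mem_ofPred_eq] at h h' e
  have := hinj g x g'' x' h.2.2 h'.2.2
    (by rw [hP _ _ h.2.2, hP _ _ h'.2.2, ← h.2.1, ← h'.2.1]) e
  subst this
  rw [mul_left_cancel e]

theorem lam_apply {G : Type*} [Group G] (g x : G) (ξ : lp (fun _ : G => ℂ) 2) :
    lam g ξ x = ξ (g⁻¹ * x) := rfl

/-- Haagerup's inequality. -/
theorem haagerup_inequality {k : ℕ} (n : ℕ) (f : FreeGroup (Fin k) →₀ ℂ)
    (hf : ∀ g ∈ f.support, FreeGroup.norm g = n) :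
    ‖∑ g ∈ f.support, f g • lam g‖ ≤ (n + 1) * Real.sqrt (∑ g ∈ f.support, ‖f g‖ ^ 2) := by
  classical
  refine ContinuousLinearMap.opNorm_le_bound _ (by positivity) fun ξ => ?_
  have h2 : (0 : ℝ) < (2 : ℝ≥0∞).toReal := by norm_num
  have hM : ∀ t : Finset (FreeGroup (Fin k)), ∑ y ∈ t, ‖ξ y‖ ^ 2 ≤ ‖ξ‖ ^ 2 := by
    intro t
    have := lp.sum_rpow_le_norm_rpow h2 ξ t
    simpa using this
  refine lp.norm_le_of_forall_sum_le h2 (by positivity) fun s => ?_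
  simp only [ENNReal.toReal_ofNat, Real.rpow_two]
  have happ : ∀ x, ((∑ g ∈ f.support, f g • lam g) ξ) x =
      ∑ g ∈ f.support, f g * ξ (g⁻¹ * x) := by
    intro x
    simp only [_root_.sum_apply, lp.coeFn_sum]
    rw [Finset.sum_apply]
    rfl
  let P : ℕ → FreeGroup (Fin k) → FreeGroup (Fin k) → Prop := fun p g x =>
    g.toWord.take (n - p) = x.toWord.take (n - p) ∧
      g.toWord = g.toWord.take (n - p) ++ FreeGroup.invRev ((g⁻¹ * x).toWord.take p)
  have hx : ∀ x ∈ s, ‖((∑ g ∈ f.support, f g • lam g) ξ) x‖ ^ 2 ≤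
      (n + 1) * ∑ p ∈ Finset.range (n + 1),
        (∑ g ∈ f.support with P p g x, ‖f g‖ * ‖ξ (g⁻¹ * x)‖) ^ 2 := by
    intro x _
    have hb : ‖((∑ g ∈ f.support, f g • lam g) ξ) x‖ ≤ ∑ p ∈ Finset.range (n + 1),
        ∑ g ∈ f.support with P p g x, ‖f g‖ * ‖ξ (g⁻¹ * x)‖ := by
      rw [happ]
      refine (norm_sum_le _ _).trans ?_
      simp only [Finset.sum_filter]
      rw [Finset.sum_comm]
      refine Finset.sum_le_sum fun g hg => ?_
      obtain ⟨p, hp, hp'⟩ := group_split n g x (hf g hg)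
      refine le_trans ?_ (Finset.single_le_sum (fun _ _ => ?_) hp)
      · rw [if_pos hp', norm_mul]
      · split_ifs <;> positivity
    refine (pow_le_pow_left₀ (norm_nonneg _) hb 2).trans ?_
    refine sq_sum_le_card_mul_sum_sq.trans (le_of_eq ?_)
    simp
  refine (Finset.sum_le_sum hx).trans ?_
  rw [← Finset.mul_sum, Finset.sum_comm]
  have hp : ∀ p ∈ Finset.range (n + 1), ∑ x ∈ s,
      (∑ g ∈ f.support with P p g x, ‖f g‖ * ‖ξ (g⁻¹ * x)‖) ^ 2 ≤
      (∑ g ∈ f.support, ‖f g‖ ^ 2) * ‖ξ‖ ^ 2 := by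
    intro p _
    refine piece_bound f.support s f ξ (fun g => g.toWord.take (n - p)) (P p)
      (fun g x h => h.1) ?_ _ hM
    intro g x g' x' h h' ha e
    apply FreeGroup.toWord_injective
    rw [h.2, h'.2, e]
    rw [ha]
  have hfin := Finset.sum_le_sum hp
  rw [Finset.sum_const, Finset.card_range, nsmul_eq_mul] at hfin
  refine (mul_le_mul_of_nonneg_left hfin (by positivity)).trans (le_of_eq ?_)
  rw [mul_pow, mul_pow, Real.sq_sqrt (Finset.sum_nonneg fun _ _ => sq_nonneg _)]
  push_cast
  ring
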